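/- Let τ ∈ ℂ with Im τ > 0, η ∈ ℂ, Λ₁,…,Λₙ ∈ ℂ with a_k = ηΛ_k, z₁,…,zₙ ∈ ℂ, λ ∈ ℂ, and m₁,…,mₙ nonnegative integers with m = m₁+…+mₙ. Then for every k = 1,…,n and all t = (t₁,…,t_m) where both sides are defined, ω_{m₁,…,mₙ}(t,λ; z₁,…,z_k+τ,…,zₙ; τ) = e^{b_k} · ω_{m₁,…,mₙ}(t,λ; z₁,…,z_k,…,zₙ; τ), where b_k = 2πi m_k (λ + 2η m_k − 2 ∑_{l=1}^{k−1} (a_l − 2η m_l)) + 4πi a_k ∑_{l=k+1}^{n} m_l. -/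

import Mathlib

open Complex Finset

/-- The first Jacobi theta function
`θ(t,τ) = −∑_{j∈ℤ} exp(πi(j+1/2)²τ + 2πi(j+1/2)(t+1/2))`. -/
noncomputable def jacobiTheta1 (t τ : ℂ) : ℂ :=
  -∑' j : ℤ, Complex.exp (Real.pi * I * (j + 1/2) ^ 2 * τ +
    2 * Real.pi * I * (j + 1/2) * (t + 1/2))

/-- `u(t) = ∏_{i<j} θ(t_i−t_j+2η)/θ(t_i−t_j)`. -/
noncomputable def uFn (τ η : ℂ) {m : ℕ} (t : Fin m → ℂ) : ℂ :=
  ∏ i : Fin m, ∏ j : Fin m,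
    if i < j then jacobiTheta1 (t i - t j + 2 * η) τ / jacobiTheta1 (t i - t j) τ
    else 1

open scoped Classical in
/-- The weight function `ω_{m₁,…,mₙ}(t₁,…,t_m,λ;z;τ)` (with `a_k = ηΛ_k`);
the sum over tuples of disjoint subsets `I₁,…,Iₙ` with `|I_k| = m_k` is encoded
as a sum over maps `σ : Fin m → Fin n` with fibers of cardinalities `m_k`
(`I_k = σ⁻¹(k)`). -/
noncomputable def weightFn (τ η lam : ℂ) {n m : ℕ} (Λ z : Fin n → ℂ)
    (mv : Fin n → ℕ) (t : Fin m → ℂ) : ℂ :=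
  (uFn τ η t)⁻¹ *
    ∑ σ : Fin m → Fin n,
      if ∀ k : Fin n, (Finset.univ.filter fun i => σ i = k).card = mv k then
        (∏ i : Fin m, ∏ k : Fin n,
          if k < σ i then
            jacobiTheta1 (t i - z k + η * Λ k) τ /
              jacobiTheta1 (t i - z k - η * Λ k) τ
          else 1) *
        (∏ i : Fin m, ∏ j : Fin m,
          if σ i < σ j then
            jacobiTheta1 (t i - t j + 2 * η) τ / jacobiTheta1 (t i - t j) τ
          else 1) *
        (∏ j : Fin m,
          jacobiTheta1 (lam + t j - z (σ j) - η * Λ (σ j) + 2 * η * (mv (σ j) : ℂ) -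
              2 * η * ∑ l ∈ Finset.univ.filter (fun l : Fin n => l < σ j),
                (Λ l - 2 * (mv l : ℂ))) τ /
            jacobiTheta1 (t j - z (σ j) - η * Λ (σ j)) τ)
      else 0

/-- All theta-denominators occurring in the weight function are nonzero at `t`. -/
def wfDefined (τ η : ℂ) {n m : ℕ} (Λ z : Fin n → ℂ) (t : Fin m → ℂ) : Prop :=
  (∀ i j : Fin m, i ≠ j → jacobiTheta1 (t i - t j) τ ≠ 0) ∧
  (∀ i j : Fin m, i ≠ j → jacobiTheta1 (t i - t j + 2 * η) τ ≠ 0) ∧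
  (∀ (i : Fin m) (k : Fin n), jacobiTheta1 (t i - z k - η * Λ k) τ ≠ 0)

theorem theta_sub_tau (x τ : ℂ) : jacobiTheta1 (x - τ) τ =
    Complex.exp (-(Real.pi * I * τ) + 2 * Real.pi * I * (x + 1/2)) * jacobiTheta1 x τ := by
  unfold jacobiTheta1
  rw [mul_neg, ← tsum_mul_left, ← (Equiv.addRight (1 : ℤ)).tsum_eq]
  congr 1
  apply tsum_congr
  intro j
  rw [← Complex.exp_add]
  congr 1
  simp only [Equiv.coe_addRight]
  push_cast
  ring

theorem theta_ratio (x y τ : ℂ) : jacobiTheta1 (x - τ) τ / jacobiTheta1 (y - τ) τ =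
    Complex.exp (2 * Real.pi * I * (x - y)) * (jacobiTheta1 x τ / jacobiTheta1 y τ) := by
  rw [theta_sub_tau, theta_sub_tau, mul_div_mul_comm, ← Complex.exp_sub]
  congr 2
  ring

theorem prod_exp_ite {m : ℕ} (p : Fin m → Prop) [DecidablePred p] (c : ℂ) :
    ∏ i : Fin m, (if p i then Complex.exp c else 1) =
      Complex.exp (((Finset.univ.filter p).card : ℂ) * c) := by
  rw [Finset.prod_ite, Finset.prod_const, Finset.prod_const_one, mul_one, ← Complex.exp_nat_mul]

/-- Transformation of the weight functions under the shift `z_k → z_k + τ`: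
`ω_{m₁,…,mₙ}(t,λ;…,z_k+τ,…;τ) = e^{b_k} ω_{m₁,…,mₙ}(t,λ;…,z_k,…;τ)` with
`b_k = 2πi m_k(λ + 2η m_k − 2∑_{l<k}(a_l − 2η m_l)) + 4πi a_k ∑_{l>k} m_l`,
`a_l = ηΛ_l`. -/
theorem weightFn_shift_z_tau (τ η lam : ℂ) (n m : ℕ) (Λ z : Fin n → ℂ)
    (mv : Fin n → ℕ) (hτ : 0 < τ.im) (hm : ∑ k, mv k = m) (k : Fin n)
    (t : Fin m → ℂ) (ht : wfDefined τ η Λ z t)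
    (ht' : wfDefined τ η Λ (Function.update z k (z k + τ)) t) :
    weightFn τ η lam Λ (Function.update z k (z k + τ)) mv t =
      Complex.exp (2 * Real.pi * I * ((mv k : ℂ)) *
          (lam + 2 * η * (mv k : ℂ) -
            2 * ∑ l ∈ Finset.univ.filter (fun l : Fin n => l < k),
              (η * Λ l - 2 * η * (mv l : ℂ))) +
        4 * Real.pi * I * (η * Λ k) *
          ∑ l ∈ Finset.univ.filter (fun l : Fin n => k < l), (mv l : ℂ)) *
        weightFn τ η lam Λ z mv t := by
  classical
  unfold weightFn
  rw [mul_left_comm]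
  congr 1
  rw [Finset.mul_sum]
  apply Finset.sum_congr rfl
  intro σ _
  split_ifs with hσ
  swap
  · rw [mul_zero]
  have h1 : (∏ i : Fin m, ∏ l : Fin n,
          if l < σ i then
            jacobiTheta1 (t i - (Function.update z k (z k + τ)) l + η * Λ l) τ /
              jacobiTheta1 (t i - (Function.update z k (z k + τ)) l - η * Λ l) τ
          else 1) = Complex.exp (4 * Real.pi * I * (η * Λ k) *
          ∑ l ∈ Finset.univ.filter (fun l : Fin n => k < l), (mv l : ℂ)) *
        (∏ i : Fin m, ∏ l : Fin n,
          if l < σ i then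
            jacobiTheta1 (t i - z l + η * Λ l) τ /
              jacobiTheta1 (t i - z l - η * Λ l) τ
          else 1) := by
    have hc : ((Finset.univ.filter fun i => k < σ i).card : ℂ) =
        ∑ l ∈ Finset.univ.filter (fun l : Fin n => k < l), (mv l : ℂ) := by
      rw [Finset.card_eq_sum_card_fiberwise (f := σ)
        (t := Finset.univ.filter (fun l : Fin n => k < l))]
      · push_cast
        apply Finset.sum_congr rfl
        intro l hl
        rw [← hσ l, Finset.filter_filter]
        congr 2
        ext i
        simp only [Finset.mem_filter, Finset.mem_univ, true_and] at hl ⊢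
        constructor
        · exact fun h => h.2
        · exact fun h => ⟨h ▸ hl, h⟩
      · intro i hi
        simpa using hi
    rw [← hc, mul_comm (4 * Real.pi * I * (η * Λ k)), ← prod_exp_ite, ← Finset.prod_mul_distrib]
    apply Finset.prod_congr rfl
    intro i _
    have : (if k < σ i then Complex.exp (4 * Real.pi * I * (η * Λ k)) else 1) =
        ∏ l : Fin n, if l = k then
          (if k < σ i then Complex.exp (4 * Real.pi * I * (η * Λ k)) else 1) else 1 := by
      rw [Finset.prod_ite_eq' Finset.univ k]
      simp
    rw [this, ← Finset.prod_mul_distrib]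
    apply Finset.prod_congr rfl
    intro l _
    by_cases hl : l = k
    · subst hl
      simp only [if_true, Function.update_self]
      split_ifs
      · have e1 : t i - (z l + τ) + η * Λ l = (t i - z l + η * Λ l) - τ := by ring
        have e2 : t i - (z l + τ) - η * Λ l = (t i - z l - η * Λ l) - τ := by ring
        rw [e1, e2, theta_ratio]
        congr 2
        ring
      · simp
    · simp [hl]
  have h3 : (∏ j : Fin m,
          jacobiTheta1 (lam + t j - (Function.update z k (z k + τ)) (σ j) - η * Λ (σ j) +
              2 * η * (mv (σ j) : ℂ) -
              2 * η * ∑ l ∈ Finset.univ.filter (fun l : Fin n => l < σ j),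
                (Λ l - 2 * (mv l : ℂ))) τ /
            jacobiTheta1 (t j - (Function.update z k (z k + τ)) (σ j) - η * Λ (σ j)) τ) =
      Complex.exp (2 * Real.pi * I * ((mv k : ℂ)) *
          (lam + 2 * η * (mv k : ℂ) -
            2 * ∑ l ∈ Finset.univ.filter (fun l : Fin n => l < k),
              (η * Λ l - 2 * η * (mv l : ℂ)))) *
      (∏ j : Fin m,
          jacobiTheta1 (lam + t j - z (σ j) - η * Λ (σ j) + 2 * η * (mv (σ j) : ℂ) -
              2 * η * ∑ l ∈ Finset.univ.filter (fun l : Fin n => l < σ j),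
                (Λ l - 2 * (mv l : ℂ))) τ /
            jacobiTheta1 (t j - z (σ j) - η * Λ (σ j)) τ) := by
    have hs : ∑ l ∈ Finset.univ.filter (fun l : Fin n => l < k),
        (η * Λ l - 2 * η * (mv l : ℂ)) =
        η * ∑ l ∈ Finset.univ.filter (fun l : Fin n => l < k), (Λ l - 2 * (mv l : ℂ)) := by
      rw [Finset.mul_sum]
      apply Finset.sum_congr rfl
      intro l _
      ring
    rw [hs]
    generalize hf : (fun q : Fin n => ∑ l ∈ Finset.univ.filter (fun l : Fin n => l < q),
      (Λ l - 2 * (mv l : ℂ))) = S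
    have hS : ∀ q : Fin n, ∑ l ∈ Finset.univ.filter (fun l : Fin n => l < q),
      (Λ l - 2 * (mv l : ℂ)) = S q := fun q => congrFun hf q
    simp only [hS]
    have hcard : (mv k : ℂ) = ((Finset.univ.filter fun i => σ i = k).card : ℂ) := by rw [hσ k]
    have hexp : Complex.exp (2 * Real.pi * I * ((mv k : ℂ)) *
          (lam + 2 * η * (mv k : ℂ) - 2 * (η * S k))) =
        ∏ i : Fin m, (if σ i = k then Complex.exp (2 * Real.pi * I *
          (lam + 2 * η * (mv k : ℂ) - 2 * (η * S k))) else 1) := by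
      rw [prod_exp_ite, ← hcard]
      congr 1
      ring
    rw [hexp, ← Finset.prod_mul_distrib]
    apply Finset.prod_congr rfl
    intro j _
    by_cases hj : σ j = k
    · rw [if_pos hj, hj, Function.update_self]
      have e1 : lam + t j - (z k + τ) - η * Λ k + 2 * η * (mv k : ℂ) - 2 * η * S k =
        (lam + t j - z k - η * Λ k + 2 * η * (mv k : ℂ) - 2 * η * S k) - τ := by ring
      have e2 : t j - (z k + τ) - η * Λ k = (t j - z k - η * Λ k) - τ := by ring
      rw [e1, e2, theta_ratio]
      congr 2
      ring
    · rw [if_neg hj, Function.update_of_ne hj, one_mul]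
  rw [h1, h3, Complex.exp_add]
  ring
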